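/- arXiv:1604.01139 — 5 statements merged into one kernel-verified Lean document; each statement's English description precedes it below -/
import Mathlib

section
/- Let Ω ⊊ ℂ be a domain such that the complement of Ω in the Riemann sphere ℂ̂ has exactly two connected components, each containing more than one point, and such that ℂ∖Ω ⊆ ℝ. Then there exists a ℂ-affine automorphism σ of ℂ such that either σ(Ω) = 𝒯(s) for some s>0, or σ(Ω) = 𝓕(s,t) for some s,t>1. -/
open Set

/-- The Teichmüller ring `𝒯(s) = ℂ ∖ ([−1,0] ∪ [s,+∞))`. -/
def teichRing (s : ℝ) : Set ℂ :=
  ((fun x : ℝ => (x : ℂ)) '' (Icc (-1) 0 ∪ Ici s))ᶜ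

/-- The double Teichmüller ring `𝓕(s,t) = ℂ ∖ ((−∞,−s] ∪ [−1,1] ∪ [t,+∞))`. -/
def doubleTeichRing (s t : ℝ) : Set ℂ :=
  ((fun x : ℝ => (x : ℂ)) '' (Iic (-s) ∪ Icc (-1) 1 ∪ Ici t))ᶜ

/-- `Ω ⊆ ℂ` is a non-degenerate doubly connected domain: it is open, connected,
and the complement of its image in the Riemann sphere (the one-point
compactification of `ℂ`) consists of exactly two connected components, each of
which contains more than one point.  (Such a decomposition into two disjoint
nonempty closed connected sets is exactly the decomposition into the two
connected components of the complement.) -/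
def IsNondegenDoublyConnected (Ω : Set ℂ) : Prop :=
  IsOpen Ω ∧ IsConnected Ω ∧
    ∃ E₁ E₂ : Set (OnePoint ℂ),
      ((fun z : ℂ => (z : OnePoint ℂ)) '' Ω)ᶜ = E₁ ∪ E₂ ∧ Disjoint E₁ E₂ ∧
      IsClosed E₁ ∧ IsClosed E₂ ∧ IsConnected E₁ ∧ IsConnected E₂ ∧
      E₁.Nontrivial ∧ E₂.Nontrivial

/-- The inclusion of the real line in the Riemann sphere. -/
def realToSphere (x : ℝ) : OnePoint ℂ := ((x : ℂ) : OnePoint ℂ)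

theorem isEmbedding_realToSphere : Topology.IsEmbedding realToSphere :=
  OnePoint.isOpenEmbedding_coe.isEmbedding.comp Complex.isometry_ofReal.isEmbedding

theorem image_affine_compl_ofReal_image {c d : ℝ} (hc : c ≠ 0) {S T : Set ℝ}
    (h : ∀ y, y ∈ S ↔ c * y + d ∈ T) :
    (fun z : ℂ => (c : ℂ)⁻¹ * z + (-d / c : ℂ)) '' ((fun x : ℝ => (x : ℂ)) '' T)ᶜ =
      ((fun x : ℝ => (x : ℂ)) '' S)ᶜ := by
  have hc' : (c : ℂ) ≠ 0 := by exact_mod_cast hc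
  have hbij : Function.Bijective (fun z : ℂ => (c : ℂ)⁻¹ * z + (-d / c : ℂ)) := by
    refine Function.bijective_iff_has_inverse.2 ⟨fun w => c * w + d, fun z => ?_, fun w => ?_⟩
    · field_simp; ring
    · field_simp; ring
  rw [image_compl_eq hbij, image_image]
  congr 1
  ext z
  constructor
  · rintro ⟨x, hx, rfl⟩
    refine ⟨c⁻¹ * x + -d / c, (h _).2 ?_, by push_cast; rfl⟩
    convert hx using 1
    field_simp; ring
  · rintro ⟨y, hy, rfl⟩
    refine ⟨c * y + d, (h y).1 hy, ?_⟩
    push_cast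
    field_simp; ring

theorem lower_part_eq_empty_or_Iic {F : Set ℝ} (hF : IsClosed F)
    (hgap : ∀ u v, u ∉ F → v ∉ F → F ∩ Ioo u v = ∅) {a : ℝ} (ha : a ∉ F) :
    F ∩ Iio a = ∅ ∨ ∃ p < a, F ∩ Iio a = Iic p := by
  have heq : F ∩ Iio a = F ∩ Iic a := by
    ext x
    refine ⟨fun h => ⟨h.1, mem_Iic.2 (le_of_lt h.2)⟩,
      fun h => ⟨h.1, mem_Iio.2 (lt_of_le_of_ne h.2 ?_)⟩⟩
    rintro rfl
    exact ha h.1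
  rcases (F ∩ Iio a).eq_empty_or_nonempty with h | h
  · exact Or.inl h
  · right
    have hbdd : BddAbove (F ∩ Iio a) := ⟨a, fun x hx => le_of_lt hx.2⟩
    have hp : sSup (F ∩ Iio a) ∈ F ∩ Iio a :=
      (heq ▸ hF.inter isClosed_Iic : IsClosed (F ∩ Iio a)).csSup_mem h hbdd
    refine ⟨_, hp.2, Subset.antisymm (fun x hx => le_csSup hbdd hx) fun y hy => ?_⟩
    refine ⟨?_, mem_Iio.2 (lt_of_le_of_lt (mem_Iic.1 hy) hp.2)⟩
    by_contra hyF
    have hlt : y < sSup (F ∩ Iio a) := lt_of_le_of_ne hy fun h => hyF (h ▸ hp.1)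
    exact (hgap y a hyF ha).subset ⟨hp.1, hlt, hp.2⟩

theorem upper_part_eq_empty_or_Ici {F : Set ℝ} (hF : IsClosed F)
    (hgap : ∀ u v, u ∉ F → v ∉ F → F ∩ Ioo u v = ∅) {b : ℝ} (hb : b ∉ F) :
    F ∩ Ioi b = ∅ ∨ ∃ q > b, F ∩ Ioi b = Ici q := by
  have hgap' : ∀ u v, u ∉ -F → v ∉ -F → -F ∩ Ioo u v = ∅ := by
    intro u v hu hv
    have := congrArg Neg.neg (hgap (-v) (-u) hv hu)
    simpa using this
  have hb' : -b ∉ -F := by simpa using hb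
  rcases lower_part_eq_empty_or_Iic hF.neg hgap' hb' with h | ⟨p, hp, h⟩
  · left
    simpa using congrArg Neg.neg h
  · refine Or.inr ⟨-p, by linarith, ?_⟩
    simpa using congrArg Neg.neg h

theorem inter_Ioo_eq_empty_of_isPreconnected {E : Set (OnePoint ℂ)}
    (hE : IsPreconnected E) (hinf : OnePoint.infty ∈ E)
    (hreal : ∀ z : ℂ, (z : OnePoint ℂ) ∈ E → z.im = 0) (u v : ℝ)
    (hu : u ∉ realToSphere ⁻¹' E) (hv : v ∉ realToSphere ⁻¹' E) :
    realToSphere ⁻¹' E ∩ Ioo u v = ∅ := by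
  by_contra hne
  obtain ⟨x, hxE, hx⟩ := nonempty_iff_ne_empty.2 hne
  have hstrip : IsOpen {z : ℂ | u < z.re ∧ z.re < v} :=
    (isOpen_lt continuous_const Complex.continuous_re).inter
      (isOpen_lt Complex.continuous_re continuous_const)
  have hclosed : IsClosed (((fun z : ℂ => (z : OnePoint ℂ)) '' {z : ℂ | u < z.re ∧ z.re < v})ᶜ) :=
    (OnePoint.isOpenEmbedding_coe.isOpenMap _ hstrip).isClosed_compl
  have hclosed' : IsClosed (realToSphere '' Icc u v) :=
    (isCompact_Icc.image isEmbedding_realToSphere.continuous).isClosed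
  have hcover : E ⊆ realToSphere '' Icc u v ∪
      ((fun z : ℂ => (z : OnePoint ℂ)) '' {z : ℂ | u < z.re ∧ z.re < v})ᶜ := by
    intro w hw
    by_cases h : w ∈ (fun z : ℂ => (z : OnePoint ℂ)) '' {z : ℂ | u < z.re ∧ z.re < v}
    · obtain ⟨z, hz, rfl⟩ := h
      refine Or.inl ⟨z.re, ⟨hz.1.le, hz.2.le⟩, ?_⟩
      exact congrArg OnePoint.some (Complex.ext rfl (hreal z hw).symm)
    · exact Or.inr h
  obtain ⟨w, hwE, ⟨y, hy, rfl⟩, hwc⟩ := isPreconnected_closed_iff.1 hE _ _ hclosed' hclosed hcover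
    ⟨realToSphere x, hxE, x, ⟨hx.1.le, hx.2.le⟩, rfl⟩
    ⟨OnePoint.infty, hinf, by simp⟩
  have huy : u < y := lt_of_le_of_ne hy.1 fun h => hu (h ▸ hwE)
  have hyv : y < v := lt_of_le_of_ne hy.2 fun h => hv (h ▸ hwE)
  exact hwc ⟨(y : ℂ), ⟨by simpa using huy, by simpa using hyv⟩, rfl⟩

theorem preimage_realToSphere_eq_Icc {E : Set (OnePoint ℂ)} (hclosed : IsClosed E)
    (hE : IsConnected E) (hnontriv : E.Nontrivial) (hsub : E ⊆ range realToSphere) :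
    ∃ a b : ℝ, a < b ∧ realToSphere ⁻¹' E = Icc a b := by
  have himage : realToSphere '' (realToSphere ⁻¹' E) = E := image_preimage_eq_of_subset hsub
  have hcompact : IsCompact (realToSphere ⁻¹' E) := by
    rw [isEmbedding_realToSphere.isCompact_iff, himage]
    exact hclosed.isCompact
  have hconn : IsConnected (realToSphere ⁻¹' E) := by
    refine ⟨(himage.symm ▸ hE.nonempty : (realToSphere '' _).Nonempty).of_image, ?_⟩
    rw [← isEmbedding_realToSphere.isInducing.isPreconnected_image, himage]
    exact hE.isPreconnected
  have hIcc := eq_Icc_of_connected_compact hconn hcompact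
  refine ⟨_, _, ?_, hIcc⟩
  obtain ⟨x, hx, y, hy, hxy⟩ := nontrivial_of_image realToSphere _ (himage.symm ▸ hnontriv)
  rw [hIcc] at hx hy
  by_contra hle
  exact hxy (by linarith [hx.1, hx.2, hy.1, hy.2])

theorem exists_affine_of_Icc_union_Ici {a b q : ℝ} (hab : a < b) (hbq : b < q) :
    ∃ α β : ℂ, α ≠ 0 ∧ ∃ s : ℝ, 0 < s ∧
      (fun z : ℂ => α * z + β) '' ((fun x : ℝ => (x : ℂ)) '' (Icc a b ∪ Ici q))ᶜ =
        teichRing s := by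
  have hc : 0 < b - a := sub_pos.2 hab
  have hs : (b - a) * ((q - b) / (b - a)) = q - b := by field_simp
  have hcC : ((b - a : ℝ) : ℂ) ≠ 0 := by exact_mod_cast hc.ne'
  refine ⟨((b - a : ℝ) : ℂ)⁻¹, -(b : ℝ) / ((b - a : ℝ) : ℂ), inv_ne_zero hcC,
    (q - b) / (b - a), div_pos (sub_pos.2 hbq) hc, ?_⟩
  refine image_affine_compl_ofReal_image hc.ne' fun y => ?_
  have h₁ := mul_le_mul_iff_right₀ (b := -1) (c := y) hc
  have h₂ := mul_le_mul_iff_right₀ (b := y) (c := 0) hc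
  have h₃ := mul_le_mul_iff_right₀ (b := (q - b) / (b - a)) (c := y) hc
  rw [hs] at h₃
  simp only [mem_union, mem_Icc, mem_Ici, ← h₁, ← h₂, ← h₃]
  refine or_congr (and_congr ?_ ?_) ?_ <;> constructor <;> intro h <;> linarith

theorem exists_affine_of_Iic_union_Icc {a b p : ℝ} (hab : a < b) (hpa : p < a) :
    ∃ α β : ℂ, α ≠ 0 ∧ ∃ s : ℝ, 0 < s ∧
      (fun z : ℂ => α * z + β) '' ((fun x : ℝ => (x : ℂ)) '' (Iic p ∪ Icc a b))ᶜ =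
        teichRing s := by
  have hc : 0 < b - a := sub_pos.2 hab
  have hs : (b - a) * ((a - p) / (b - a)) = a - p := by field_simp
  have hcR : -(b - a) ≠ 0 := neg_ne_zero.2 hc.ne'
  have hcC : ((-(b - a) : ℝ) : ℂ) ≠ 0 := by exact_mod_cast hcR
  refine ⟨((-(b - a) : ℝ) : ℂ)⁻¹, -(a : ℝ) / ((-(b - a) : ℝ) : ℂ), inv_ne_zero hcC,
    (a - p) / (b - a), div_pos (sub_pos.2 hpa) hc, ?_⟩
  refine image_affine_compl_ofReal_image hcR fun y => ?_
  have h₁ := mul_le_mul_iff_right₀ (b := -1) (c := y) hc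
  have h₂ := mul_le_mul_iff_right₀ (b := y) (c := 0) hc
  have h₃ := mul_le_mul_iff_right₀ (b := (a - p) / (b - a)) (c := y) hc
  rw [hs] at h₃
  simp only [mem_union, mem_Icc, mem_Ici, mem_Iic, ← h₁, ← h₂, ← h₃]
  rw [or_comm, and_comm]
  refine or_congr ?_ (and_congr ?_ ?_) <;> constructor <;> intro h <;> linarith

theorem exists_affine_of_Iic_union_Icc_union_Ici {a b p q : ℝ} (hab : a < b) (hpa : p < a)
    (hbq : b < q) :
    ∃ α β : ℂ, α ≠ 0 ∧ ∃ s t : ℝ, 1 < s ∧ 1 < t ∧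
      (fun z : ℂ => α * z + β) '' ((fun x : ℝ => (x : ℂ)) '' (Iic p ∪ Icc a b ∪ Ici q))ᶜ =
        doubleTeichRing s t := by
  obtain ⟨c, hcdef⟩ : ∃ c, c = (b - a) / 2 := ⟨_, rfl⟩
  obtain ⟨d, hddef⟩ : ∃ d, d = (a + b) / 2 := ⟨_, rfl⟩
  have hc : 0 < c := by linarith
  have hs : c * ((d - p) / c) = d - p := by field_simp
  have ht : c * ((q - d) / c) = q - d := by field_simp
  have hcC : (c : ℂ) ≠ 0 := by exact_mod_cast hc.ne'
  refine ⟨(c : ℂ)⁻¹, -(d : ℂ) / (c : ℂ), inv_ne_zero hcC, (d - p) / c, (q - d) / c,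
    (one_lt_div hc).2 (by linarith), (one_lt_div hc).2 (by linarith), ?_⟩
  refine image_affine_compl_ofReal_image hc.ne' fun y => ?_
  have h₁ := mul_le_mul_iff_right₀ (b := -1) (c := y) hc
  have h₂ := mul_le_mul_iff_right₀ (b := y) (c := 1) hc
  have h₃ := mul_le_mul_iff_right₀ (b := y) (c := -((d - p) / c)) hc
  have h₄ := mul_le_mul_iff_right₀ (b := (q - d) / c) (c := y) hc
  rw [mul_neg, hs] at h₃
  rw [ht] at h₄
  simp only [mem_union, mem_Icc, mem_Ici, mem_Iic, ← h₁, ← h₂, ← h₃, ← h₄]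
  refine or_congr (or_congr ?_ (and_congr ?_ ?_)) ?_ <;> constructor <;> intro h <;> linarith

theorem exists_affine_of_infty_mem {Ω : Set ℂ} (hreal : Ωᶜ ⊆ {z : ℂ | z.im = 0})
    {E₁ E₂ : Set (OnePoint ℂ)} (hunion : ((fun z : ℂ => (z : OnePoint ℂ)) '' Ω)ᶜ = E₁ ∪ E₂)
    (hdisj : Disjoint E₁ E₂) (hclosed₁ : IsClosed E₁) (hclosed₂ : IsClosed E₂)
    (hE₁ : IsConnected E₁) (hE₂ : IsConnected E₂) (hnontriv₁ : E₁.Nontrivial)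
    (hnontriv₂ : E₂.Nontrivial) (hinf : OnePoint.infty ∈ E₂) :
    ∃ α β : ℂ, α ≠ 0 ∧
      ((∃ s : ℝ, 0 < s ∧ (fun z : ℂ => α * z + β) '' Ω = teichRing s) ∨
        (∃ s t : ℝ, 1 < s ∧ 1 < t ∧
          (fun z : ℂ => α * z + β) '' Ω = doubleTeichRing s t)) := by
  have hmem : ∀ z : ℂ, z ∉ Ω ↔ (z : OnePoint ℂ) ∈ E₁ ∪ E₂ := by
    intro z
    rw [← hunion, mem_compl_iff, OnePoint.coe_injective.mem_set_image]
  have him : ∀ z : ℂ, (z : OnePoint ℂ) ∈ E₁ ∪ E₂ → z.im = 0 := fun z hz =>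
    hreal ((hmem z).2 hz)
  have hrange : ∀ w ∈ E₁ ∪ E₂, w ≠ OnePoint.infty → w ∈ range realToSphere := by
    intro w hw hne
    obtain ⟨z, rfl⟩ := OnePoint.ne_infty_iff_exists.1 hne
    exact ⟨z.re, congrArg OnePoint.some (Complex.ext rfl (him z hw).symm)⟩
  obtain ⟨a, b, hab, hIcc⟩ := preimage_realToSphere_eq_Icc hclosed₁ hE₁ hnontriv₁ fun w hw =>
    hrange w (Or.inl hw) fun h => hdisj.notMem_of_mem_left hw (h ▸ hinf)
  obtain ⟨F, hF⟩ : ∃ F, F = realToSphere ⁻¹' E₂ := ⟨_, rfl⟩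
  have hFclosed : IsClosed F := hF ▸ hclosed₂.preimage isEmbedding_realToSphere.continuous
  have hFdisj : Disjoint (Icc a b) F := by
    rw [← hIcc, hF]
    exact hdisj.preimage _
  have hgap : ∀ u v, u ∉ F → v ∉ F → F ∩ Ioo u v = ∅ := by
    rw [hF]
    exact inter_Ioo_eq_empty_of_isPreconnected hE₂.isPreconnected hinf fun z hz => him z (Or.inr hz)
  have hFnonempty : F.Nonempty := by
    obtain ⟨w, hw, hne⟩ := hnontriv₂.exists_ne OnePoint.infty
    obtain ⟨x, rfl⟩ := hrange w (Or.inr hw) hne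
    exact ⟨x, hF ▸ hw⟩
  have hΩ : Ω = ((fun x : ℝ => (x : ℂ)) '' (F ∩ Iio a ∪ Icc a b ∪ F ∩ Ioi b))ᶜ := by
    have hsplit : F ∩ Iio a ∪ Icc a b ∪ F ∩ Ioi b = Icc a b ∪ F := by
      ext x
      simp only [mem_union, mem_inter_iff, mem_Icc, mem_Iio, mem_Ioi]
      rcases lt_or_ge x a with h | h <;> rcases lt_or_ge b x with h' | h' <;> grind
    rw [hsplit, ← hIcc, hF, ← preimage_union, eq_compl_comm]
    ext z
    rw [mem_compl_iff, hmem]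
    constructor
    · rintro ⟨x, hx, rfl⟩
      exact hx
    · intro hz
      have hzre : ((z.re : ℝ) : ℂ) = z := Complex.ext rfl (him z hz).symm
      refine ⟨z.re, ?_, hzre⟩
      rw [mem_preimage, realToSphere, hzre]
      exact hz
  rcases lower_part_eq_empty_or_Iic hFclosed hgap
      (hFdisj.notMem_of_mem_left (left_mem_Icc.2 hab.le)) with hL | ⟨p, hp, hL⟩ <;>
  rcases upper_part_eq_empty_or_Ici hFclosed hgap
      (hFdisj.notMem_of_mem_left (right_mem_Icc.2 hab.le)) with hR | ⟨q, hq, hR⟩ <;>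
  rw [hL, hR] at hΩ <;> rw [hΩ]
  · obtain ⟨x, hx⟩ := hFnonempty
    have h₁ : ¬ x < a := fun h => hL.subset ⟨hx, h⟩
    have h₂ : ¬ b < x := fun h => hR.subset ⟨hx, h⟩
    exact absurd hx (hFdisj.notMem_of_mem_left ⟨not_lt.1 h₁, not_lt.1 h₂⟩)
  · rw [empty_union]
    obtain ⟨α, β, hα, h⟩ := exists_affine_of_Icc_union_Ici hab hq
    exact ⟨α, β, hα, Or.inl h⟩
  · rw [union_empty]
    obtain ⟨α, β, hα, h⟩ := exists_affine_of_Iic_union_Icc hab hp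
    exact ⟨α, β, hα, Or.inl h⟩
  · obtain ⟨α, β, hα, h⟩ := exists_affine_of_Iic_union_Icc_union_Ici hab hp hq
    exact ⟨α, β, hα, Or.inr h⟩

/-- If `Ω ⊊ ℂ` is a non-degenerate doubly connected domain whose
complement `ℂ ∖ Ω` is contained in the real line, then some ℂ-affine
automorphism `σ(z) = α·z + β` maps `Ω` onto a Teichmüller ring `𝒯(s)`, `s > 0`,
or onto a double Teichmüller ring `𝓕(s,t)`, `s,t > 1`. -/
theorem normalize_real_complement (Ω : Set ℂ) (hne : Ω ≠ univ)
    (hdc : IsNondegenDoublyConnected Ω)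
    (hreal : Ωᶜ ⊆ {z : ℂ | z.im = 0}) :
    ∃ α β : ℂ, α ≠ 0 ∧
      ((∃ s : ℝ, 0 < s ∧ (fun z : ℂ => α * z + β) '' Ω = teichRing s) ∨
        (∃ s t : ℝ, 1 < s ∧ 1 < t ∧
          (fun z : ℂ => α * z + β) '' Ω = doubleTeichRing s t)) := by
  obtain ⟨-, -, E₁, E₂, hunion, hdisj, hc₁, hc₂, hE₁, hE₂, hn₁, hn₂⟩ := hdc
  have hinf : OnePoint.infty ∈ E₁ ∪ E₂ := by
    rw [← hunion]
    simp
  rcases hinf with h | h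
  · exact exists_affine_of_infty_mem hreal (hunion.trans (union_comm _ _)) hdisj.symm
      hc₂ hc₁ hE₂ hE₁ hn₂ hn₁ h
  · exact exists_affine_of_infty_mem hreal hunion hdisj hc₁ hc₂ hE₁ hE₂ hn₁ hn₂ h
end

section
/- Let s,t>1, and set s' = (s−1)(t−1)/((s+1)(t+1)) ∈ (0,1). The Möbius transformation φ(z) = ((t−1)/(s+1))·(z+s)/(t−z) is holomorphic and injective on 𝓕(s,t), and φ(𝓕(s,t)) = ℂ∖((−∞,0]∪[s',1]). -/
open Set

/-- On the real axis away from its pole `t`, the Möbius transformation pulls the removed set of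
the image back to the removed set of the double Teichmüller ring. -/
theorem mobius_real_mem_iff {s t x : ℝ} (hs : 1 < s) (ht : 1 < t) (hx : x ≠ t) :
    (t - 1) / (s + 1) * ((x + s) / (t - x)) ∈
        Iic (0 : ℝ) ∪ Icc ((s - 1) * (t - 1) / ((s + 1) * (t + 1))) 1 ↔
      x ∈ Iic (-s) ∪ Icc (-1) 1 ∪ Ici t := by
  have hs1 : 0 < s + 1 := by linarith
  have ht1 : 0 < t - 1 := by linarith
  have ht2 : 0 < t + 1 := by linarith
  simp only [mem_union, mem_Iic, mem_Icc, mem_Ici]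
  rcases lt_or_gt_of_ne hx with h | h
  · have hd : 0 < t - x := by linarith
    have h0 : (t - 1) / (s + 1) * ((x + s) / (t - x)) ≤ 0 ↔ x ≤ -s := by
      rw [div_mul_div_comm, div_le_iff₀ (by positivity), zero_mul]
      constructor <;> intro h' <;> nlinarith
    have h1 : (t - 1) / (s + 1) * ((x + s) / (t - x)) ≤ 1 ↔ x ≤ 1 := by
      rw [div_mul_div_comm, div_le_iff₀ (by positivity)]
      constructor <;> intro h' <;> nlinarith
    have h2 : (s - 1) * (t - 1) / ((s + 1) * (t + 1)) ≤
        (t - 1) / (s + 1) * ((x + s) / (t - x)) ↔ -1 ≤ x := by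
      have e : (t - 1) / (s + 1) * ((x + s) / (t - x)) -
          (s - 1) * (t - 1) / ((s + 1) * (t + 1)) =
          (t - 1) * (s + t) / ((s + 1) * (t + 1) * (t - x)) * (x + 1) := by
        field_simp
        ring
      have hc : 0 < (t - 1) * (s + t) / ((s + 1) * (t + 1) * (t - x)) := by
        have : 0 < s + t := by linarith
        positivity
      rw [← sub_nonneg, e, mul_nonneg_iff_of_pos_left hc]
      constructor <;> intro h' <;> linarith
    rw [h0, h1, h2]
    simp [not_le.mpr h]
  · refine iff_of_true (Or.inl ?_) (Or.inr h.le)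
    exact mul_nonpos_of_nonneg_of_nonpos (by positivity)
      (div_nonpos_of_nonneg_of_nonpos (by linarith) (by linarith))

/-- For `s,t > 1`, with `s' = (s−1)(t−1)/((s+1)(t+1)) ∈ (0,1)`, the
Möbius transformation `φ(z) = ((t−1)/(s+1))·(z+s)/(t−z)` is holomorphic and
injective on `𝓕(s,t)`, and maps it onto `ℂ ∖ ((−∞,0] ∪ [s',1])`. -/
theorem mobius_image_doubleTeichRing (s t : ℝ) (hs : 1 < s) (ht : 1 < t) :
    0 < (s - 1) * (t - 1) / ((s + 1) * (t + 1)) ∧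
    (s - 1) * (t - 1) / ((s + 1) * (t + 1)) < 1 ∧
    DifferentiableOn ℂ
      (fun z : ℂ => (((t : ℂ) - 1) / ((s : ℂ) + 1)) * ((z + s) / ((t : ℂ) - z)))
      (doubleTeichRing s t) ∧
    Set.InjOn
      (fun z : ℂ => (((t : ℂ) - 1) / ((s : ℂ) + 1)) * ((z + s) / ((t : ℂ) - z)))
      (doubleTeichRing s t) ∧
    (fun z : ℂ => (((t : ℂ) - 1) / ((s : ℂ) + 1)) * ((z + s) / ((t : ℂ) - z))) ''
        (doubleTeichRing s t) =
      ((fun x : ℝ => (x : ℂ)) ''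
        (Iic 0 ∪ Icc ((s - 1) * (t - 1) / ((s + 1) * (t + 1))) 1))ᶜ := by
  have hs1 : 0 < s + 1 := by linarith
  have ht1 : 0 < t - 1 := by linarith
  have ht2 : 0 < t + 1 := by linarith
  have hs0 : 0 < s - 1 := by linarith
  have hne : ∀ z ∈ doubleTeichRing s t, (t : ℂ) - z ≠ 0 := fun z hz h =>
    hz ⟨t, Or.inr self_mem_Ici, sub_eq_zero.mp h⟩
  have hsC : (s : ℂ) + 1 ≠ 0 := by exact_mod_cast hs1.ne'
  have htC : (t : ℂ) - 1 ≠ 0 := by exact_mod_cast ht1.ne'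
  have hstC : (s : ℂ) + t ≠ 0 := by exact_mod_cast (by linarith : 0 < s + t).ne'
  have hinj : Set.InjOn
      (fun z : ℂ => (((t : ℂ) - 1) / ((s : ℂ) + 1)) * ((z + s) / ((t : ℂ) - z)))
      {z | (t : ℂ) - z ≠ 0} := by
    intro z hz w hw h
    have h' := mul_left_cancel₀ (div_ne_zero htC hsC) h
    rw [div_eq_div_iff hz hw] at h'
    apply mul_left_cancel₀ hstC
    linear_combination h'
  -- the preimage of a point `w` off the value at infinity
  have hsurj : ∀ w : ℂ, (s + 1) * w + (t - 1) ≠ 0 →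
      (t : ℂ) - (t * (s + 1) * w - s * (t - 1)) / ((s + 1) * w + (t - 1)) ≠ 0 ∧
      ((t : ℂ) - 1) / (s + 1) *
        (((t * (s + 1) * w - s * (t - 1)) / ((s + 1) * w + (t - 1)) + s) /
          (t - (t * (s + 1) * w - s * (t - 1)) / ((s + 1) * w + (t - 1)))) = w := by
    intro w hw
    have e1 : (t : ℂ) - (t * (s + 1) * w - s * (t - 1)) / ((s + 1) * w + (t - 1)) =
        (t - 1) * (s + t) / ((s + 1) * w + (t - 1)) := by
      field_simp
      ring
    have e2 : (t * (s + 1) * w - s * (t - 1)) / ((s + 1) * w + (t - 1)) + (s : ℂ) =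
        (s + 1) * (s + t) * w / ((s + 1) * w + (t - 1)) := by
      field_simp
      ring
    rw [e1, e2]
    refine ⟨div_ne_zero (mul_ne_zero htC hstC) hw, ?_⟩
    field_simp
  refine ⟨by positivity, ?_, ?_, hinj.mono hne, ?_⟩
  · rw [div_lt_one (by positivity)]
    nlinarith
  · intro z hz
    have := hne z hz
    exact DifferentiableAt.differentiableWithinAt (by fun_prop (disch := assumption))
  · ext w
    constructor
    · rintro ⟨z, hz, rfl⟩ ⟨y, hy, hyz⟩
      have hzt := hne z hz
      simp only at hyz
      have hw : ((s : ℂ) + 1) * y + (t - 1) ≠ 0 := by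
        rw [hyz]
        have : ((s : ℂ) + 1) * ((t - 1) / (s + 1) * ((z + s) / (t - z))) + (t - 1) =
            (t - 1) * (s + t) / (t - z) := by
          field_simp
          ring
        rw [this]
        exact div_ne_zero (mul_ne_zero htC hstC) hzt
      obtain ⟨hxt, hxy⟩ := hsurj y hw
      set x : ℝ := (t * (s + 1) * y - s * (t - 1)) / ((s + 1) * y + (t - 1)) with hx
      have hxC : (x : ℂ) = (t * (s + 1) * y - s * (t - 1)) / ((s + 1) * y + (t - 1)) := by
        rw [hx]
        push_cast
        rfl
      rw [← hxC] at hxt hxy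
      have hxz : (x : ℂ) = z := hinj hxt hzt (hxy.trans hyz)
      refine hz ⟨x, (mobius_real_mem_iff hs ht ?_).mp ?_, hxz⟩
      · rintro h
        exact hxt (by rw [h, sub_self])
      · convert hy using 1
        exact_mod_cast hxy
    · intro hw
      have hw' : ((s : ℂ) + 1) * w + (t - 1) ≠ 0 := by
        intro h
        refine hw ⟨-((t - 1) / (s + 1)), Or.inl ?_, ?_⟩
        · have : 0 ≤ (t - 1) / (s + 1) := by positivity
          exact neg_nonpos.mpr this
        · push_cast
          field_simp
          linear_combination -h
      obtain ⟨hzt, hzw⟩ := hsurj w hw'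
      refine ⟨_, ?_, hzw⟩
      rintro ⟨x, hx, hxz⟩
      simp only at hxz
      rw [← hxz] at hzt hzw
      refine hw ⟨_, (mobius_real_mem_iff hs ht ?_).mpr hx, ?_⟩
      · rintro h
        exact hzt (by rw [h, sub_self])
      · simpa using hzw
end

section
/- Let 0<a<b<1. The Möbius transformation ψ(z) = z/(1−z) is holomorphic and injective on 𝒢(a,b), and ψ(𝒢(a,b)) = ℂ∖((−∞,0] ∪ [a/(1−a), b/(1−b)]). -/
open Set

/-- The ring `𝒢(a,b) = ℂ ∖ ((−∞,0] ∪ [a,b] ∪ [1,+∞))`, the complement being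
taken of subsets of the real axis inside `ℂ`. -/
def gRing (a b : ℝ) : Set ℂ :=
  ((fun x : ℝ => (x : ℂ)) '' (Iic 0 ∪ Icc a b ∪ Ici 1))ᶜ

/-- The real form of the inverse map `y ↦ y / (1 + y)` carries the complement of the image into
the complement of `gRing a b`. -/
theorem div_one_add_mem {a b y : ℝ} (ha : a < 1) (hb : b < 1) (hy : 1 + y ≠ 0)
    (h : y ∈ Iic 0 ∪ Icc (a / (1 - a)) (b / (1 - b))) (hpos : 0 < a) :
    y / (1 + y) ∈ Iic 0 ∪ Icc a b ∪ Ici 1 := by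
  have ha' : 0 < 1 - a := sub_pos.2 ha
  rcases h with h | ⟨h₁, h₂⟩
  · rcases lt_or_gt_of_ne hy with hneg | hy'
    · refine Or.inr ?_
      rw [mem_Ici, le_div_iff_of_neg hneg]
      linarith
    · exact Or.inl (Or.inl (div_nonpos_of_nonpos_of_nonneg h hy'.le))
  · have hy' : 0 < 1 + y := by linarith [div_pos hpos ha']
    rw [div_le_iff₀ ha'] at h₁
    rw [le_div_iff₀ (sub_pos.2 hb)] at h₂
    refine Or.inl (Or.inr ⟨?_, ?_⟩)
    · rw [le_div_iff₀ hy']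
      linarith
    · rw [div_le_iff₀ hy']
      linarith

/-- The real form of `x ↦ x / (1 - x)` carries the complement of `gRing a b` into
the complement of the image. -/
theorem div_one_sub_mem {a b x : ℝ} (ha : a < 1) (hb : b < 1)
    (h : x ∈ Iic 0 ∪ Icc a b ∪ Ici 1) :
    x / (1 - x) ∈ Iic 0 ∪ Icc (a / (1 - a)) (b / (1 - b)) := by
  rcases h with (h | ⟨h₁, h₂⟩) | h
  · rw [mem_Iic] at h
    exact Or.inl (div_nonpos_of_nonpos_of_nonneg h (by linarith))
  · have hx' : 0 < 1 - x := by linarith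
    refine Or.inr ⟨?_, ?_⟩
    · rw [div_le_div_iff₀ (sub_pos.2 ha) hx']
      linarith
    · rw [div_le_div_iff₀ hx' (sub_pos.2 hb)]
      linarith
  · rw [mem_Ici] at h
    exact Or.inl (div_nonpos_of_nonneg_of_nonpos (zero_le_one.trans h) (sub_nonpos.2 h))

theorem one_sub_ne_zero_of_mem_gRing {a b : ℝ} {z : ℂ} (hz : z ∈ gRing a b) : 1 - z ≠ 0 :=
  fun h => hz ⟨1, Or.inr self_mem_Ici, Complex.ofReal_one.trans (sub_eq_zero.1 h)⟩

/-- For `0 < a < b < 1`, the Möbius transformation `ψ(z) = z/(1−z)`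
is holomorphic and injective on `𝒢(a,b)`, and maps it onto
`ℂ ∖ ((−∞,0] ∪ [a/(1−a), b/(1−b)])`. -/
theorem mobius_image_gRing (a b : ℝ) (ha : 0 < a) (hab : a < b) (hb : b < 1) :
    DifferentiableOn ℂ (fun z : ℂ => z / (1 - z)) (gRing a b) ∧
    Set.InjOn (fun z : ℂ => z / (1 - z)) (gRing a b) ∧
    (fun z : ℂ => z / (1 - z)) '' gRing a b =
      ((fun x : ℝ => (x : ℂ)) '' (Iic 0 ∪ Icc (a / (1 - a)) (b / (1 - b))))ᶜ := by
  have ha1 : a < 1 := hab.trans hb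
  refine ⟨?_, ?_, ?_⟩
  · exact differentiableOn_id.div (differentiableOn_id.const_sub 1)
      fun z hz => one_sub_ne_zero_of_mem_gRing hz
  · intro z hz w hw h
    have hz' := one_sub_ne_zero_of_mem_gRing hz
    have hw' := one_sub_ne_zero_of_mem_gRing hw
    linear_combination (div_eq_div_iff hz' hw').1 h
  · ext w
    constructor
    · rintro ⟨z, hz, rfl⟩ ⟨y, hy, hyz⟩
      have h : (y : ℂ) * (1 - z) = z := (eq_div_iff (one_sub_ne_zero_of_mem_gRing hz)).1 hyz
      have hy1 : (1 : ℂ) + y ≠ 0 := fun h0 =>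
        one_ne_zero (α := ℂ) (by linear_combination (1 - z) * h0 - h)
      refine hz ⟨y / (1 + y), div_one_add_mem ha1 hb (mod_cast hy1) hy ha, ?_⟩
      push_cast
      rw [div_eq_iff hy1]
      linear_combination h
    · intro hw
      have hw1 : 1 + w ≠ 0 := fun h0 =>
        hw ⟨-1, Or.inl (by norm_num), by push_cast; linear_combination -h0⟩
      have hsub : 1 - w / (1 + w) = 1 / (1 + w) := by
        field_simp
        ring
      refine ⟨w / (1 + w), ?_, ?_⟩
      · rintro ⟨x, hx, hxw⟩
        have hx1 : (1 : ℂ) - x ≠ 0 := by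
          rw [show (x : ℂ) = w / (1 + w) from hxw, hsub]
          exact one_div_ne_zero hw1
        have h : (x : ℂ) * (1 + w) = w := (eq_div_iff hw1).1 hxw
        refine hw ⟨x / (1 - x), div_one_sub_mem ha1 hb hx, ?_⟩
        push_cast
        rw [div_eq_iff hx1]
        linear_combination h
      · simp only [hsub]
        field_simp
end

section
/- Let α ∈ (1, 3/2). The map h(z) = Re(z^α) + i·Im z is a bijection from the slit plane ℂ∖(−∞,0] onto itself. -/
/-- On a horizontal line off the real axis, `Re (z ^ α)` grows at least linearly in `Re z`. -/
theorem exists_pos_monotone_re_cpow_sub {α : ℝ} (hα : α ∈ Set.Ioo (1 : ℝ) (3 / 2)) {y : ℝ}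
    (hy : y ≠ 0) :
    ∃ c : ℝ, 0 < c ∧ Monotone fun x : ℝ => (((⟨x, y⟩ : ℂ) ^ (α : ℂ)).re - c * x) := by
  obtain ⟨h1, h2⟩ := hα
  have hcos : 0 < Real.cos ((α - 1) * Real.pi) :=
    Real.cos_pos_of_mem_Ioo ⟨by nlinarith [Real.pi_pos], by nlinarith [Real.pi_pos]⟩
  refine ⟨α * (|y| ^ (α - 1) * Real.cos ((α - 1) * Real.pi)), by positivity, ?_⟩
  refine monotone_of_hasDerivAt_nonneg
    (f' := fun x => α * (‖(⟨x, y⟩ : ℂ)‖ ^ (α - 1) *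
      Real.cos (Complex.arg ⟨x, y⟩ * (α - 1))) -
      α * (|y| ^ (α - 1) * Real.cos ((α - 1) * Real.pi))) (fun x => ?_) (fun x => ?_)
  · have hz : (⟨x, y⟩ : ℂ) ∈ Complex.slitPlane := Or.inr hy
    have hline : HasDerivAt (fun w : ℂ => w + y * Complex.I) 1 (x : ℂ) :=
      (hasDerivAt_id _).add_const _
    rw [Complex.mk_eq_add_mul_I] at hz
    have key := (hline.cpow_const (c := (α : ℂ)) hz).real_of_complex
    simp only [← Complex.mk_eq_add_mul_I] at key
    have hre : ((α : ℂ) * (⟨x, y⟩ : ℂ) ^ ((α : ℂ) - 1) * 1).re =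
        α * (‖(⟨x, y⟩ : ℂ)‖ ^ (α - 1) * Real.cos (Complex.arg ⟨x, y⟩ * (α - 1))) := by
      rw [mul_one, Complex.re_ofReal_mul, ← Complex.cpow_ofReal_re]
      push_cast
      rfl
    rw [hre] at key
    exact key.sub (hasDerivAt_const_mul (α * (|y| ^ (α - 1) * Real.cos ((α - 1) * Real.pi))))
  · have hnorm : |y| ≤ ‖(⟨x, y⟩ : ℂ)‖ := Complex.abs_im_le_norm ⟨x, y⟩
    have harg : Real.cos ((α - 1) * Real.pi) ≤ Real.cos (Complex.arg ⟨x, y⟩ * (α - 1)) := by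
      rw [← Real.cos_abs (Complex.arg _ * _), abs_mul, abs_of_pos (sub_pos.2 h1), mul_comm]
      have := Complex.abs_arg_le_pi ⟨x, y⟩
      have := Real.pi_pos
      have := sub_pos.2 h1
      exact Real.cos_le_cos_of_nonneg_of_le_pi (by positivity) (by nlinarith) (by gcongr)
    have : 0 ≤ α - 1 := by linarith
    exact sub_nonneg.2 (by gcongr)

/-- On a horizontal line off the real axis, `Re (z ^ α)` is a bijective function of `Re z`. -/
theorem bijective_re_cpow_of_im_ne_zero {α : ℝ} (hα : α ∈ Set.Ioo (1 : ℝ) (3 / 2)) {y : ℝ}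
    (hy : y ≠ 0) : Function.Bijective fun x : ℝ => ((⟨x, y⟩ : ℂ) ^ (α : ℂ)).re := by
  obtain ⟨c, hc, hmono⟩ := exists_pos_monotone_re_cpow_sub hα hy
  have hlin : StrictMono fun x : ℝ => c * x := fun a b h => mul_lt_mul_of_pos_left h hc
  have hsum := hmono.add_strictMono hlin
  simp only [sub_add_cancel] at hsum
  refine ⟨hsum.injective, Continuous.surjective ?_ ?_ ?_⟩
  · simp only [Complex.mk_eq_add_mul_I]
    refine Complex.continuous_re.comp (Continuous.cpow (by fun_prop) continuous_const fun x => ?_)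
    exact Or.inr (by simpa using hy)
  · refine Filter.tendsto_atTop_mono' _ ?_ (Filter.tendsto_atTop_add_const_left Filter.atTop
      ((⟨0, y⟩ : ℂ) ^ (α : ℂ)).re (Filter.tendsto_id.const_mul_atTop hc))
    filter_upwards [Filter.eventually_ge_atTop 0] with x hx
    have := hmono hx
    simp only [mul_zero, sub_zero, id] at this ⊢
    linarith
  · refine Filter.tendsto_atBot_mono' _ ?_ (Filter.tendsto_atBot_add_const_left Filter.atBot
      ((⟨0, y⟩ : ℂ) ^ (α : ℂ)).re (Filter.tendsto_id.const_mul_atBot hc))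
    filter_upwards [Filter.eventually_le_atBot 0] with x hx
    have := hmono hx
    simp only [mul_zero, sub_zero, id] at this ⊢
    linarith

theorem re_cpow_mk_zero {α x : ℝ} (hx : 0 ≤ x) :
    ((⟨x, 0⟩ : ℂ) ^ (α : ℂ)).re = x ^ α := by
  change (((x : ℂ)) ^ (α : ℂ)).re = x ^ α
  rw [← Complex.ofReal_cpow hx, Complex.ofReal_re]

/-- For `α ∈ (1, 3/2)`, the map `h(z) = Re(z^α) + i·Im z`
(principal branch of the power) is a bijection from the slit plane
`ℂ ∖ (−∞,0]` onto itself. -/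
theorem shear_bijOn_slitPlane (α : ℝ) (hα : α ∈ Set.Ioo (1 : ℝ) (3 / 2)) :
    Set.BijOn (fun z : ℂ => (((z ^ (α : ℂ)).re : ℂ) + Complex.I * ((z.im : ℝ) : ℂ)))
      Complex.slitPlane Complex.slitPlane := by
  have hα0 : α ≠ 0 := (zero_lt_one.trans hα.1).ne'
  have hmap : (fun z : ℂ => (((z ^ (α : ℂ)).re : ℂ) + Complex.I * ((z.im : ℝ) : ℂ))) =
      fun z : ℂ => ⟨(z ^ (α : ℂ)).re, z.im⟩ := by
    funext z
    apply Complex.ext <;> simp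
  rw [hmap]
  refine ⟨?_, ?_, ?_⟩
  · rintro ⟨x, y⟩ hz
    rcases eq_or_ne y 0 with rfl | hy
    · have hx : 0 < x := by simpa [Complex.mem_slitPlane_iff] using hz
      exact Or.inl ((re_cpow_mk_zero hx.le).symm ▸ Real.rpow_pos_of_pos hx α)
    · exact Or.inr hy
  · rintro ⟨x, y⟩ hz ⟨x', y'⟩ hz' h
    obtain ⟨hre, rfl : y = y'⟩ := Complex.mk.inj h
    rcases eq_or_ne y 0 with rfl | hy
    · have hx : 0 < x := by simpa [Complex.mem_slitPlane_iff] using hz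
      have hx' : 0 < x' := by simpa [Complex.mem_slitPlane_iff] using hz'
      rw [re_cpow_mk_zero hx.le, re_cpow_mk_zero hx'.le] at hre
      rw [(Real.rpow_left_inj hx.le hx'.le hα0).1 hre]
    · rw [(bijective_re_cpow_of_im_ne_zero hα hy).injective hre]
  · rintro ⟨u, y⟩ hw
    rcases eq_or_ne y 0 with rfl | hy
    · have hu : 0 < u := by simpa [Complex.mem_slitPlane_iff] using hw
      have hx : 0 < u ^ α⁻¹ := Real.rpow_pos_of_pos hu _
      refine ⟨⟨u ^ α⁻¹, 0⟩, Or.inl hx, ?_⟩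
      exact Complex.ext ((re_cpow_mk_zero hx.le).trans (Real.rpow_inv_rpow hu.le hα0)) rfl
    · obtain ⟨x, hx⟩ := (bijective_re_cpow_of_im_ne_zero hα hy).surjective u
      exact ⟨⟨x, y⟩, Or.inr hy, Complex.ext hx rfl⟩
end

section
/- Let α ∈ (1, 3/2) and 0<a<b<1. The map h(z) = Re(z^α) + i·Im z, restricted to 𝒢(a^{1/α}, b^{1/α}), is a homeomorphism from 𝒢(a^{1/α}, b^{1/α}) onto 𝒢(a,b), and its real and imaginary parts are harmonic functions on 𝒢(a^{1/α}, b^{1/α}); that is, h is a harmonic homeomorphism between these two double Teichmüller-type rings. -/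
open Set

/-- A real-valued function is harmonic on `s ⊆ ℂ`: it is `C²` there and
satisfies the Laplace equation `u_xx + u_yy = 0`. -/
def HarmonicOnReal (u : ℂ → ℝ) (s : Set ℂ) : Prop :=
  ContDiffOn ℝ 2 u s ∧ ∀ z ∈ s,
    fderiv ℝ (fun w => fderiv ℝ u w 1) z 1 +
      fderiv ℝ (fun w => fderiv ℝ u w Complex.I) z Complex.I = 0

/-- A complex-valued function is harmonic on `s ⊆ ℂ` if its real and imaginary
parts are real-valued harmonic functions on `s`. -/
def HarmonicOnCplx (h : ℂ → ℂ) (s : Set ℂ) : Prop :=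
  HarmonicOnReal (fun z => (h z).re) s ∧ HarmonicOnReal (fun z => (h z).im) s

/-- `h` is a harmonic homeomorphism from `Ω` onto `Ω'`: harmonic on `Ω`,
continuous and injective on `Ω`, with image `Ω'`, and open as a map on `Ω`
(so that its inverse is continuous). -/
def IsHarmonicHomeoOn (h : ℂ → ℂ) (Ω Ω' : Set ℂ) : Prop :=
  HarmonicOnCplx h Ω ∧ ContinuousOn h Ω ∧ Set.InjOn h Ω ∧ h '' Ω = Ω' ∧
    ∀ U ⊆ Ω, IsOpen U → IsOpen (h '' U)

open Complex in
/-- The real part of a holomorphic function is harmonic. -/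
lemma harmonicOnReal_re {f : ℂ → ℂ} {s : Set ℂ} (hs : IsOpen s) (hf : DifferentiableOn ℂ f s) :
    HarmonicOnReal (fun z => (f z).re) s := by
  have key : ∀ (g : ℂ → ℂ), DifferentiableOn ℂ g s → ∀ z ∈ s, ∀ v : ℂ,
      fderiv ℝ (fun w => (g w).re) z v = (deriv g z * v).re := by
    intro g hg z hz v
    have h1 : HasFDerivAt g _ z := ((hg.differentiableAt (hs.mem_nhds hz)).hasDerivAt).complexToReal_fderiv
    have h2 := reCLM.hasFDerivAt.comp z h1
    have h3 : fderiv ℝ (fun w => (g w).re) z = _ := h2.fderiv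
    rw [h3]
    simp
  refine ⟨?_, fun z hz => ?_⟩
  · have h1 : ContDiffOn ℂ 2 f s := hf.contDiffOn hs
    exact reCLM.contDiff.comp_contDiffOn (h1.restrict_scalars ℝ)
  · have hd : DifferentiableOn ℂ (deriv f) s := hf.deriv hs
    have e : ∀ v : ℂ, fderiv ℝ (fun w => fderiv ℝ (fun z => (f z).re) w v) z v
        = (deriv (deriv f) z * v * v).re := by
      intro v
      have he : (fun w => fderiv ℝ (fun z => (f z).re) w v) =ᶠ[nhds z]
          fun w => (deriv f w * v).re := by
        filter_upwards [hs.mem_nhds hz] with w hw using key f hf w hw v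
      rw [he.fderiv_eq, key _ (hd.mul_const v) z hz v,
        deriv_mul_const (hd.differentiableAt (hs.mem_nhds hz))]
    rw [e, e]
    simp [mul_assoc]

lemma mem_gRing_iff {a b : ℝ} {z : ℂ} :
    z ∈ gRing a b ↔ z.im = 0 → 0 < z.re ∧ z.re < 1 ∧ (z.re < a ∨ b < z.re) := by
  have h : z ∈ (fun x : ℝ => (x : ℂ)) '' (Iic 0 ∪ Icc a b ∪ Ici 1) ↔
      z.im = 0 ∧ z.re ∈ Iic 0 ∪ Icc a b ∪ Ici 1 := by
    constructor
    · rintro ⟨x, hx, rfl⟩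
      exact ⟨Complex.ofReal_im x, by simpa using hx⟩
    · rintro ⟨h0, h1⟩
      exact ⟨z.re, h1, Complex.ext (by simp) (by simp [h0])⟩
  rw [gRing, mem_compl_iff, h]
  simp only [mem_union, mem_Iic, mem_Icc, mem_Ici]
  grind

lemma isOpen_gRing (a b : ℝ) : IsOpen (gRing a b) :=
  (Complex.isometry_ofReal.isClosedEmbedding.isClosedMap _
    ((isClosed_Iic.union isClosed_Icc).union isClosed_Ici)).isOpen_compl

lemma gRing_subset_slitPlane (a b : ℝ) : gRing a b ⊆ Complex.slitPlane := by
  intro z hz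
  rw [mem_gRing_iff] at hz
  rw [Complex.mem_slitPlane_iff]
  grind

open Complex in
/-- For `0 < β < 1/2`, the power `z ^ β` maps the plane into a sector around the positive axis. -/
lemma norm_rpow_mul_cos_le_re_cpow {β : ℝ} (h0 : 0 < β) (h1 : β < 1 / 2) {z : ℂ} (hz : z ≠ 0) :
    ‖z‖ ^ β * Real.cos (β * Real.pi) ≤ (z ^ (β : ℂ)).re := by
  rw [cpow_ofReal_re, mul_comm (arg z) β]
  refine mul_le_mul_of_nonneg_left ?_ (by positivity)
  rw [← Real.cos_abs (β * arg z), abs_mul, abs_of_pos h0]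
  have h2 := abs_arg_le_pi z
  have hpi := Real.pi_pos
  exact Real.cos_le_cos_of_nonneg_of_le_pi (by positivity) (by nlinarith) (by gcongr)

lemma cos_mul_pi_pos {β : ℝ} (h0 : 0 < β) (h1 : β < 1 / 2) : 0 < Real.cos (β * Real.pi) := by
  have hpi := Real.pi_pos
  exact Real.cos_pos_of_mem_Ioo ⟨by nlinarith, by nlinarith⟩

lemma re_cpow_sub_one_pos {α : ℝ} (hα : α ∈ Ioo (1 : ℝ) (3 / 2)) {z : ℂ} (hz : z ≠ 0) :
    0 < (α * z ^ ((α : ℂ) - 1)).re := by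
  have h0 : 0 < α - 1 := by linarith [hα.1]
  have h1 : α - 1 < 1 / 2 := by linarith [hα.2]
  have h2 := norm_rpow_mul_cos_le_re_cpow h0 h1 hz
  have h3 := cos_mul_pi_pos h0 h1
  have h4 : 0 < ‖z‖ ^ (α - 1) := Real.rpow_pos_of_pos (norm_pos_iff.2 hz) _
  rw [Complex.re_ofReal_mul]
  push_cast at h2
  have := hα.1
  have : 0 < (z ^ ((α : ℂ) - 1)).re := lt_of_lt_of_le (by positivity) h2
  positivity

lemma hasDerivAt_re_cpow_horizontal (α : ℝ) {x y : ℝ} (h : (⟨x, y⟩ : ℂ) ∈ Complex.slitPlane) :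
    HasDerivAt (fun t : ℝ => ((⟨t, y⟩ : ℂ) ^ (α : ℂ)).re)
      (α * (⟨x, y⟩ : ℂ) ^ ((α : ℂ) - 1)).re x := by
  have h1 : HasDerivAt (fun t : ℂ => t + y * Complex.I) 1 (x : ℂ) :=
    (hasDerivAt_id _).add_const _
  have e : ∀ t : ℝ, (t : ℂ) + y * Complex.I = ⟨t, y⟩ := fun t => (Complex.mk_eq_add_mul_I t y).symm
  have h2 := (h1.cpow_const (c := (α : ℂ)) (by rwa [e])).real_of_complex
  simpa [e] using h2

/-- On a horizontal line off the real axis, `Re (z ^ α)` grows at least linearly. -/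
lemma exists_mul_sub_le_re_cpow_sub {α : ℝ} (hα : α ∈ Ioo (1 : ℝ) (3 / 2)) {y : ℝ} (hy : y ≠ 0) :
    ∃ c > 0, ∀ s t : ℝ, s ≤ t →
      c * (t - s) ≤ ((⟨t, y⟩ : ℂ) ^ (α : ℂ)).re - ((⟨s, y⟩ : ℂ) ^ (α : ℂ)).re := by
  have h0 : 0 < α - 1 := by linarith [hα.1]
  have h1 : α - 1 < 1 / 2 := by linarith [hα.2]
  have hα0 : 0 < α := by linarith
  have h3 := cos_mul_pi_pos h0 h1
  have hy' := abs_pos.2 hy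
  have hd : ∀ x, HasDerivAt (fun t : ℝ => ((⟨t, y⟩ : ℂ) ^ (α : ℂ)).re)
      (α * (⟨x, y⟩ : ℂ) ^ ((α : ℂ) - 1)).re x := fun x =>
    hasDerivAt_re_cpow_horizontal α (Complex.mem_slitPlane_iff.2 (Or.inr hy))
  refine ⟨α * (|y| ^ (α - 1) * Real.cos ((α - 1) * Real.pi)), by positivity, fun s t hst => ?_⟩
  refine mul_sub_le_image_sub_of_le_deriv (fun x => (hd x).differentiableAt) (fun x => ?_) hst
  rw [(hd x).deriv, Complex.re_ofReal_mul]
  have hz : (⟨x, y⟩ : ℂ) ≠ 0 := fun h => hy (congrArg Complex.im h)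
  have h2 := norm_rpow_mul_cos_le_re_cpow h0 h1 hz
  push_cast at h2
  refine mul_le_mul_of_nonneg_left (le_trans ?_ h2) hα0.le
  have h5 : |y| ≤ ‖(⟨x, y⟩ : ℂ)‖ := Complex.abs_im_le_norm ⟨x, y⟩
  gcongr

lemma bijective_re_cpow_horizontal {α : ℝ} (hα : α ∈ Ioo (1 : ℝ) (3 / 2)) {y : ℝ} (hy : y ≠ 0) :
    Function.Bijective (fun t : ℝ => ((⟨t, y⟩ : ℂ) ^ (α : ℂ)).re) := by
  obtain ⟨c, hc, h⟩ := exists_mul_sub_le_re_cpow_sub hα hy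
  set g : ℝ → ℝ := fun t => ((⟨t, y⟩ : ℂ) ^ (α : ℂ)).re with hg
  have hmono : StrictMono g := fun s t hst => by
    have h1 := h s t hst.le
    have h2 : 0 < c * (t - s) := mul_pos hc (sub_pos.2 hst)
    simp only [hg]
    linarith
  have hcont : Continuous g := continuous_iff_continuousAt.2 fun x =>
    (hasDerivAt_re_cpow_horizontal α (Complex.mem_slitPlane_iff.2 (Or.inr hy))).continuousAt
  refine ⟨hmono.injective, fun u => ?_⟩
  refine mem_range_of_exists_le_of_exists_ge hcont ?_ ?_
  · refine ⟨-(|u - g 0| / c), ?_⟩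
    have h1 := h (-(|u - g 0| / c)) 0 (neg_nonpos.2 (by positivity))
    have h2 : c * (0 - -(|u - g 0| / c)) = |u - g 0| := by field_simp; ring
    rw [h2] at h1
    have := neg_abs_le (u - g 0)
    simp only [hg] at this h1 ⊢
    linarith
  · refine ⟨|u - g 0| / c, ?_⟩
    have h1 := h 0 (|u - g 0| / c) (by positivity)
    have h2 : c * (|u - g 0| / c - 0) = |u - g 0| := by field_simp; ring
    rw [h2] at h1
    have := le_abs_self (u - g 0)
    simp only [hg] at this h1 ⊢
    linarith

lemma re_cpow_of_im_eq_zero (α : ℝ) {z : ℂ} (h0 : z.im = 0) (h : 0 ≤ z.re) :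
    (z ^ (α : ℂ)).re = z.re ^ α := by
  have : z = (z.re : ℂ) := Complex.ext rfl (by simp [h0])
  rw [this, ← Complex.ofReal_cpow (by simpa using h)]
  simp

/-- Shearing `z ^ α` to have imaginary part `Im z` gives a local homeomorphism. -/
lemma map_nhds_shear_cpow {α : ℝ} (hα : α ∈ Ioo (1 : ℝ) (3 / 2)) {z : ℂ}
    (hz : z ∈ Complex.slitPlane) :
    Filter.map (fun z : ℂ => (((z ^ (α : ℂ)).re : ℂ) + Complex.I * ((z.im : ℝ) : ℂ))) (nhds z) =
      nhds (((z ^ (α : ℂ)).re : ℂ) + Complex.I * ((z.im : ℝ) : ℂ)) := by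
  have h1 : HasStrictFDerivAt (fun z : ℂ => z ^ (α : ℂ)) _ z :=
    (((hasStrictDerivAt_id z).cpow_const (c := (α : ℂ)) hz)).complexToReal_fderiv
  have h2 := Complex.ofRealCLM.hasStrictFDerivAt.comp z
    (Complex.reCLM.hasStrictFDerivAt.comp z h1)
  have h3 := ((Complex.ofRealCLM.comp Complex.imCLM).hasStrictFDerivAt (x := z)).const_mul
    Complex.I
  have hp := re_cpow_sub_one_pos hα (Complex.slitPlane_ne_zero hz)
  refine (h2.add h3).map_nhds_eq_of_surj (LinearMap.range_eq_top.2 fun w => ?_)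
  set c := (α : ℂ) * z ^ ((α : ℂ) - 1) with hc
  refine ⟨⟨(w.re + c.im * w.im) / c.re, w.im⟩, ?_⟩
  apply Complex.ext
  · simp [← hc]
    field_simp
    ring
  · simp

/-- For `α ∈ (1,3/2)` and `0 < a < b < 1`, the map
`h(z) = Re(z^α) + i·Im z` (principal branch) is a harmonic homeomorphism from
`𝒢(a^{1/α}, b^{1/α})` onto `𝒢(a,b)`. -/
theorem shear_harmonic_homeo_gRing (α a b : ℝ)
    (hα : α ∈ Set.Ioo (1 : ℝ) (3 / 2)) (ha : 0 < a) (hab : a < b) (hb : b < 1) :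
    IsHarmonicHomeoOn
      (fun z : ℂ => (((z ^ (α : ℂ)).re : ℂ) + Complex.I * ((z.im : ℝ) : ℂ)))
      (gRing (a ^ (1 / α)) (b ^ (1 / α))) (gRing a b) := by
  obtain ⟨hα1, hα2⟩ := hα
  have hα0 : 0 < α := by linarith
  set h : ℂ → ℂ := fun z => (((z ^ (α : ℂ)).re : ℂ) + Complex.I * ((z.im : ℝ) : ℂ)) with hh
  have hre : ∀ z, (h z).re = (z ^ (α : ℂ)).re := fun z => by simp [hh]
  have him : ∀ z, (h z).im = z.im := fun z => by simp [hh]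
  have hslit := gRing_subset_slitPlane (a ^ (1 / α)) (b ^ (1 / α))
  have hopen := isOpen_gRing (a ^ (1 / α)) (b ^ (1 / α))
  have hmap : ∀ z ∈ gRing (a ^ (1 / α)) (b ^ (1 / α)), Filter.map h (nhds z) = nhds (h z) :=
    fun z hz => map_nhds_shear_cpow ⟨hα1, hα2⟩ (hslit hz)
  have hmem : ∀ z : ℂ, (z.im = 0 → 0 < z.re) →
      (h z ∈ gRing a b ↔ z ∈ gRing (a ^ (1 / α)) (b ^ (1 / α))) := by
    intro z hz
    rw [mem_gRing_iff, mem_gRing_iff, him, hre]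
    refine forall_congr' fun h0 => ?_
    have hpos := hz h0
    have hone : z.re ^ α < 1 ↔ z.re < 1 := by
      rw [Real.rpow_lt_one_iff_of_pos hpos]
      grind
    rw [re_cpow_of_im_eq_zero α h0 hpos.le, one_div,
      Real.lt_rpow_inv_iff_of_pos hpos.le ha.le hα0,
      Real.rpow_inv_lt_iff_of_pos (ha.trans hab).le hpos.le hα0, hone]
    simp [hpos, Real.rpow_pos_of_pos hpos]
  refine ⟨⟨?_, ?_⟩, fun z hz => ?_, fun z hz w hw hzw => ?_, ?_, fun U hU hUo => ?_⟩
  · simp only [hre]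
    refine harmonicOnReal_re hopen fun z hz => ?_
    exact (((hasDerivAt_id z).cpow_const (c := (α : ℂ)) (hslit hz))).differentiableAt.differentiableWithinAt
  · have := harmonicOnReal_re (f := fun z => -Complex.I * z) hopen
      (differentiable_id.const_mul (-Complex.I)).differentiableOn
    simpa [him] using this
  · exact ContinuousAt.continuousWithinAt (hmap z hz).le
  · have e1 : z.im = w.im := by rw [← him z, hzw, him]
    have e2 : (z ^ (α : ℂ)).re = (w ^ (α : ℂ)).re := by rw [← hre z, hzw, hre]
    refine Complex.ext ?_ e1
    by_cases h0 : w.im = 0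
    · have hz0 := ((mem_gRing_iff.1 hz) (e1.trans h0)).1.le
      have hw0 := ((mem_gRing_iff.1 hw) h0).1.le
      rw [re_cpow_of_im_eq_zero α (e1.trans h0) hz0, re_cpow_of_im_eq_zero α h0 hw0] at e2
      exact (Real.rpow_left_inj hz0 hw0 hα0.ne').1 e2
    · refine (bijective_re_cpow_horizontal ⟨hα1, hα2⟩ h0).1 ?_
      have hz' : (⟨z.re, w.im⟩ : ℂ) = z := Complex.ext rfl e1.symm
      simpa only [hz', Complex.eta] using e2
  · apply Subset.antisymm
    · rintro _ ⟨z, hz, rfl⟩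
      exact (hmem z fun h0 => (mem_gRing_iff.1 hz h0).1).2 hz
    · intro w hw
      suffices ∃ z : ℂ, (z.im = 0 → 0 < z.re) ∧ h z = w by
        obtain ⟨z, hz, rfl⟩ := this
        exact ⟨z, (hmem z hz).1 hw, rfl⟩
      by_cases h0 : w.im = 0
      · have hw0 := (mem_gRing_iff.1 hw h0).1
        have hp : 0 < w.re ^ α⁻¹ := Real.rpow_pos_of_pos hw0 _
        refine ⟨⟨w.re ^ α⁻¹, 0⟩, fun _ => hp, Complex.ext ?_ ?_⟩
        · rw [hre, re_cpow_of_im_eq_zero α (z := ⟨w.re ^ α⁻¹, 0⟩) rfl hp.le]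
          exact Real.rpow_inv_rpow hw0.le hα0.ne'
        · rw [him, h0]
      · obtain ⟨x, hx⟩ := (bijective_re_cpow_horizontal ⟨hα1, hα2⟩ h0).2 w.re
        refine ⟨⟨x, w.im⟩, fun h => absurd h h0, Complex.ext ?_ ?_⟩
        · rw [hre]
          exact hx
        · rw [him]
  · rw [isOpen_iff_mem_nhds]
    rintro _ ⟨z, hz, rfl⟩
    rw [← hmap z (hU hz)]
    exact Filter.image_mem_map (hUo.mem_nhds hz)
end
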